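/- Let S be an inverse semigroup, let e₁ and e₂ be idempotents of S with e₁ D e₂, and let f be an idempotent of S with f ≤ e₁ in the natural partial order. Then the sets { h ∈ E(S) : h ≤ e₁ and h D f } and { h ∈ E(S) : h ≤ e₂ and h D f } have the same cardinality. -/

import Mathlib

/-- An inverse semigroup: a nonempty semigroup in which every element `x` has a
unique element `y` with `x*y*x = x` and `y*x*y = y`; this `y` is `inv x`. -/
class InverseSemigroup (S : Type*) extends Semigroup S where
  nonempty : Nonempty S
  inv : S → S
  mul_inv_mul : ∀ x : S, x * inv x * x = x
  inv_mul_inv : ∀ x : S, inv x * x * inv x = inv x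
  inv_unique : ∀ x y : S, x * y * x = x → y * x * y = y → y = inv x

namespace InverseSemigroup

variable {S : Type*}

/-- The natural partial order: `s ≤ t` iff `s = e * t` for some idempotent `e`. -/
def nle [InverseSemigroup S] (s t : S) : Prop := ∃ e : S, e * e = e ∧ s = e * t

/-- Strict version of the natural partial order. -/
def nlt [InverseSemigroup S] (s t : S) : Prop := nle s t ∧ s ≠ t

/-- Green's D-relation: `s D t` iff there is `z` with `z⁻¹z = t⁻¹t` and `zz⁻¹ = ss⁻¹`. -/
def dRel [InverseSemigroup S] (s t : S) : Prop :=
  ∃ z : S, inv z * z = inv t * t ∧ z * inv z = s * inv s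

/-- `m` is the minimum element of the semilattice of idempotents `(E(S), ≤)`. -/
def IsMinIdem [InverseSemigroup S] (m : S) : Prop :=
  m * m = m ∧ ∀ f : S, f * f = f → nle m f

/-- `e` is a lonely idempotent (relative to the minimum idempotent `m`):
`G_e = {e}`, `{e}` is a D-class, `e` covers `m` in `E(S)`, and `e` is not
covered by any idempotent. -/
def Lonely [InverseSemigroup S] (m e : S) : Prop :=
  e * e = e ∧
  (∀ s : S, s * inv s = e → inv s * s = e → s = e) ∧
  (∀ s : S, dRel s e → s = e) ∧
  nlt m e ∧ (¬ ∃ h : S, h * h = h ∧ nlt m h ∧ nlt h e) ∧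
  ¬ ∃ h : S, h * h = h ∧ nlt e h ∧ ¬ ∃ h' : S, h' * h' = h' ∧ nlt e h' ∧ nlt h' h

end InverseSemigroup

open InverseSemigroup

namespace InverseSemigroup

variable {S : Type*} [InverseSemigroup S]

theorem inv_eq_self {e : S} (he : e * e = e) : inv e = e :=
  (inv_unique e e (by rw [he, he]) (by rw [he, he])).symm

theorem inv_inv_eq (a : S) : inv (inv a) = a :=
  (inv_unique (inv a) a (inv_mul_inv a) (mul_inv_mul a)).symm

theorem idem_mul_idem {e f : S} (he : e * e = e) (hf : f * f = f) :
    (e * f) * (e * f) = e * f := by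
  have hx : inv (e * f) * (e * (f * inv (e * f))) = inv (e * f) := by
    simpa only [mul_assoc] using inv_mul_inv (e * f)
  have hxe : inv (e * f) * (e * (f * (inv (e * f) * e))) = inv (e * f) * e := by
    simpa only [mul_assoc] using congrArg (· * e) hx
  have hee (x : S) : e * (e * x) = e * x := by rw [← mul_assoc, he]
  have hff (x : S) : f * (f * x) = f * x := by rw [← mul_assoc, hf]
  have hy : f * inv (e * f) * e = inv (e * f) := by
    refine inv_unique (e * f) _ ?_ ?_
    · simpa only [mul_assoc, hee, hff] using mul_inv_mul (e * f)
    · simp only [mul_assoc, hee, hff, hxe]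
  have hidem : inv (e * f) * inv (e * f) = inv (e * f) := by
    calc inv (e * f) * inv (e * f) = (f * inv (e * f) * e) * (f * inv (e * f) * e) := by rw [hy]
      _ = f * inv (e * f) * e := by simp only [mul_assoc, hxe]
      _ = inv (e * f) := hy
  have h : e * f = inv (e * f) := by rw [← inv_eq_self hidem, inv_inv_eq]
  rwa [← h] at hidem

theorem idem_comm {e f : S} (he : e * e = e) (hf : f * f = f) : e * f = f * e := by
  have hee (x : S) : e * (e * x) = e * x := by rw [← mul_assoc, he]
  have hff (x : S) : f * (f * x) = f * x := by rw [← mul_assoc, hf]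
  have hef := idem_mul_idem he hf
  have hfe := idem_mul_idem hf he
  have h : f * e = inv (e * f) := by
    refine inv_unique (e * f) _ ?_ ?_
    · simpa only [mul_assoc, hee, hff] using hef
    · simpa only [mul_assoc, hee, hff] using hfe
  rw [h, inv_eq_self hef]

theorem nle.mul_eq {h e : S} (he : e * e = e) (hle : nle h e) : h * e = h := by
  obtain ⟨u, -, rfl⟩ := hle
  rw [mul_assoc, he]

theorem nle.eq_mul {h e : S} (hh : h * h = h) (he : e * e = e) (hle : nle h e) : e * h = h := by
  rw [idem_comm he hh, hle.mul_eq he]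

/-- Conjugation by `a` carries idempotents below `a * a⁻¹` that are D-related to `f` to
idempotents below `a⁻¹ * a` that are D-related to `f`. -/
theorem conj_mem {e₁ e₂ a b f h : S} (he₁ : e₁ * e₁ = e₁)
    (hab : a * b = e₁) (hba : b * a = e₂) (haba : a * b * a = a)
    (hh : h * h = h) (hle : nle h e₁) (hD : dRel h f) :
    (b * h * a) * (b * h * a) = b * h * a ∧ nle (b * h * a) e₂ ∧ dRel (b * h * a) f := by
  have heh : e₁ * h = h := hle.eq_mul hh he₁
  have habh (x : S) : a * (b * (h * x)) = h * x := by
    rw [← mul_assoc, ← mul_assoc, hab, heh]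
  have hhx (x : S) : h * (h * x) = h * x := by rw [← mul_assoc, hh]
  have hidem : (b * h * a) * (b * h * a) = b * h * a := by
    simp only [mul_assoc, habh, hhx]
  refine ⟨hidem, ⟨b * h * a, hidem, ?_⟩, ?_⟩
  · rw [← hba]
    simp only [mul_assoc] at haba ⊢
    rw [haba]
  · obtain ⟨w, hw₁, hw₂⟩ := hD
    rw [inv_eq_self hh, hh] at hw₂
    have hhw : h * w = w := by rw [← hw₂, mul_inv_mul]
    have habw (x : S) : a * (b * (w * x)) = w * x := by
      rw [← hhw, mul_assoc, habh]
    have habw' : a * (b * w) = w := by rw [← hhw, habh]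
    have hinv : inv (b * w) = inv w * a := by
      refine (inv_unique _ _ ?_ ?_).symm
      · rw [show b * w * (inv w * a) * (b * w) = b * (w * inv w * (a * (b * w))) by
          simp only [mul_assoc], habw', mul_inv_mul]
      · rw [show inv w * a * (b * w) * (inv w * a) = inv w * (a * (b * w)) * inv w * a by
          simp only [mul_assoc], habw', inv_mul_inv]
    refine ⟨b * w, ?_, ?_⟩
    · rw [hinv, mul_assoc, habw', hw₁]
    · rw [hinv, inv_eq_self hidem, hidem, ← hw₂]
      simp only [mul_assoc]

theorem conj_conj {e a b h : S} (he : e * e = e) (hab : a * b = e)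
    (hh : h * h = h) (hle : nle h e) : a * (b * h * a) * b = h := by
  rw [show a * (b * h * a) * b = (a * b) * h * (a * b) by simp only [mul_assoc], hab,
    hle.eq_mul hh he, hle.mul_eq he]

end InverseSemigroup

/-- If e₁ D e₂ are idempotents and f is an idempotent with f ≤ e₁,
then {h ∈ E(S) : h ≤ e₁, h D f} and {h ∈ E(S) : h ≤ e₂, h D f} have the same
cardinality. -/
theorem dPartition_counts
    {S : Type*} [InverseSemigroup S]
    (e₁ e₂ f : S) (he₁ : e₁ * e₁ = e₁) (he₂ : e₂ * e₂ = e₂) (hf : f * f = f)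
    (hD : dRel e₁ e₂) (hfe : nle f e₁) :
    Nonempty ({h : S | h * h = h ∧ nle h e₁ ∧ dRel h f} ≃
      {h : S | h * h = h ∧ nle h e₂ ∧ dRel h f}) := by
  obtain ⟨z, hz₂, hz₁⟩ := hD
  rw [inv_eq_self he₂, he₂] at hz₂
  rw [inv_eq_self he₁, he₁] at hz₁
  exact ⟨{
    toFun := fun h => ⟨inv z * h.1 * z,
      conj_mem he₁ hz₁ hz₂ (mul_inv_mul z) h.2.1 h.2.2.1 h.2.2.2⟩
    invFun := fun h => ⟨z * h.1 * inv z,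
      conj_mem he₂ hz₂ hz₁ (inv_mul_inv z) h.2.1 h.2.2.1 h.2.2.2⟩
    left_inv := fun h => Subtype.ext (conj_conj he₁ hz₁ h.2.1 h.2.2.1)
    right_inv := fun h => Subtype.ext (conj_conj he₂ hz₂ h.2.1 h.2.2.1) }⟩
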